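/- arXiv:1212.5971 — 2 statements merged into one kernel-verified Lean document; each statement's English description precedes it below -/
import Mathlib

section
/- For every real number q with 0 < q < 1, the following Ramanujan-type identity with integer exponents holds: ∏_{n=0}^∞ 1/((1 − q^{6n+1})(1 − q^{6n+5})) = ∏_{n=0}^∞ 1/((1 − q^{10n+2})(1 − q^{10n+8})(1 − q^{15n+3})(1 − q^{15n+12})) + q · ∏_{n=0}^∞ 1/((1 − q^{10n+4})(1 − q^{10n+6})(1 − q^{15n+6})(1 − q^{15n+9})). -/
open scoped BigOperators

/-- The Euler product `(q)_∞ = ∏_{i=1}^∞ (1 - q^i)`. -/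
noncomputable def eulerProd (q : ℝ) : ℝ := ∏' i : ℕ, (1 - q ^ (i + 1))

/-- The Virasoro minimal model character `χ_{s,t}^{m,n}(q)`:
`q^(h - c/24) · (q)_∞⁻¹ · Σ_{k∈ℤ} q^(s t k²) (q^(k(mt-ns)) - q^((mt+ns)k+mn))`,
where `c = 1 - 6(s-t)²/(st)` and `h = ((mt-ns)² - (s-t)²)/(4st)`. -/
noncomputable def minChar (s t m n : ℤ) (q : ℝ) : ℝ :=
  q ^ ((((((m * t - n * s) ^ 2 - (s - t) ^ 2 : ℤ) : ℝ)) / (4 * (s : ℝ) * (t : ℝ))) -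
        (1 - 6 * ((s : ℝ) - (t : ℝ)) ^ 2 / ((s : ℝ) * (t : ℝ))) / 24) *
    (eulerProd q)⁻¹ *
    ∑' k : ℤ, ((q ^ (s * t * k ^ 2 + k * (m * t - n * s)) : ℝ) -
               (q ^ (s * t * k ^ 2 + (m * t + n * s) * k + m * n) : ℝ))

open Filter Topology

/-- The Gaussian binomial coefficient to the base `p ^ 2`, defined by its Pascal-type recursion. -/
noncomputable def gaussChoose (p : ℝ) : ℕ → ℕ → ℝ
  | _, 0 => 1
  | 0, _ + 1 => 0
  | n + 1, j + 1 => p ^ (2 * j + 2) * gaussChoose p n (j + 1) + gaussChoose p n j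

/-- The finite Euler product `∏_{i < n} (1 - p ^ (2 i + 2))`. -/
noncomputable def finEuler (p : ℝ) (n : ℕ) : ℝ := ∏ i ∈ Finset.range n, (1 - p ^ (2 * i + 2))

lemma gaussChoose_zero_right (p : ℝ) (n : ℕ) : gaussChoose p n 0 = 1 := by
  cases n <;> simp [gaussChoose]

lemma gaussChoose_eq_zero_of_lt (p : ℝ) {n j : ℕ} (h : n < j) : gaussChoose p n j = 0 := by
  induction n generalizing j with
  | zero => cases j with
    | zero => omega
    | succ j => simp [gaussChoose]
  | succ n ih => cases j with
    | zero => omega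
    | succ j => simp [gaussChoose, ih (show n < j + 1 by omega), ih (show n < j by omega)]

lemma gaussChoose_self (p : ℝ) (n : ℕ) : gaussChoose p n n = 1 := by
  induction n with
  | zero => simp [gaussChoose]
  | succ n ih => simp [gaussChoose, ih, gaussChoose_eq_zero_of_lt p (Nat.lt_succ_self n)]

lemma gaussChoose_add_mul_finEuler (p : ℝ) (a b : ℕ) :
    gaussChoose p (a + b) a * (finEuler p a * finEuler p b) = finEuler p (a + b) := by
  induction a generalizing b with
  | zero => simp [gaussChoose_zero_right, finEuler]
  | succ a iha =>
    induction b with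
    | zero => simp [gaussChoose_self, finEuler]
    | succ b ihb =>
      have h1 := iha (b + 1)
      rw [show a + 1 + (b + 1) = (a + b + 1) + 1 by ring, gaussChoose]
      rw [show a + 1 + b = a + b + 1 by ring] at ihb
      rw [← add_assoc] at h1
      have e : ∀ n, finEuler p (n + 1) = finEuler p n * (1 - p ^ (2 * n + 2)) := fun n ↦
        Finset.prod_range_succ _ _
      rw [e a] at ihb ⊢
      rw [e b] at h1 ⊢
      rw [e (a + b + 1)]
      linear_combination (p ^ (2 * a + 2) * (1 - p ^ (2 * b + 2))) * ihb +
        (1 - p ^ (2 * a + 2)) * h1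

/-- The finite `q`-binomial theorem. -/
lemma prod_one_add_mul_pow (p y : ℝ) (n : ℕ) :
    ∏ k ∈ Finset.range n, (1 + y * p ^ (2 * k + 1)) =
      ∑ j ∈ Finset.range (n + 1), gaussChoose p n j * p ^ (j ^ 2) * y ^ j := by
  induction n generalizing y with
  | zero => simp [gaussChoose]
  | succ n ih =>
    have h1 : ∏ k ∈ Finset.range (n + 1), (1 + y * p ^ (2 * k + 1)) =
        (∏ k ∈ Finset.range n, (1 + (y * p ^ 2) * p ^ (2 * k + 1))) * (1 + y * p) := by
      rw [Finset.prod_range_succ']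
      congr 1
      · exact Finset.prod_congr rfl fun k _ ↦ by ring
      · simp
    have h2 := Finset.sum_range_succ
      (fun j ↦ gaussChoose p n j * p ^ (j ^ 2) * (y * p ^ 2) ^ j) (n + 1)
    rw [Finset.sum_range_succ', gaussChoose_eq_zero_of_lt p (Nat.lt_succ_self n)] at h2
    simp only [gaussChoose_zero_right] at h2
    rw [h1, ih, mul_add, mul_one, Finset.sum_mul, Finset.sum_range_succ' _ (n + 1)]
    have h3 : ∑ k ∈ Finset.range (n + 1),
        gaussChoose p (n + 1) (k + 1) * p ^ ((k + 1) ^ 2) * y ^ (k + 1) =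
        ∑ k ∈ Finset.range (n + 1),
          gaussChoose p n (k + 1) * p ^ ((k + 1) ^ 2) * (y * p ^ 2) ^ (k + 1) +
        ∑ k ∈ Finset.range (n + 1), gaussChoose p n k * p ^ (k ^ 2) * (y * p ^ 2) ^ k * (y * p) := by
      rw [← Finset.sum_add_distrib]
      refine Finset.sum_congr rfl fun k _ ↦ ?_
      rw [gaussChoose]
      ring
    rw [h3, gaussChoose_zero_right]
    simp at h2 ⊢
    linear_combination -h2

lemma prod_mul_prod_eq_sum (p z : ℝ) (hp : p ≠ 0) (hz : z ≠ 0) (N : ℕ) :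
    (∏ k ∈ Finset.range N, (1 + z * p ^ (2 * k + 1))) *
      (∏ k ∈ Finset.range N, (1 + z⁻¹ * p ^ (2 * k + 1))) =
      ∑ j ∈ Finset.range (2 * N + 1),
        gaussChoose p (2 * N) j * (p ^ (((j : ℤ) - N) ^ 2) * z ^ ((j : ℤ) - N)) := by
  have h := prod_one_add_mul_pow p (z * (p ^ (2 * N))⁻¹) (2 * N)
  have h1 : ∏ k ∈ Finset.range (2 * N), (1 + z * (p ^ (2 * N))⁻¹ * p ^ (2 * k + 1)) =
      (∏ k ∈ Finset.range N, (1 + z * p ^ (2 * k + 1))) *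
      (∏ k ∈ Finset.range N, (1 + z⁻¹ * p ^ (2 * k + 1))) * (z ^ N * (p ^ (N ^ 2))⁻¹) := by
    rw [two_mul N, Finset.prod_range_add, ← Finset.prod_range_reflect]
    have e1 : ∏ k ∈ Finset.range N, (1 + z * (p ^ (N + N))⁻¹ * p ^ (2 * (N + k) + 1)) =
        ∏ k ∈ Finset.range N, (1 + z * p ^ (2 * k + 1)) :=
      Finset.prod_congr rfl fun k _ ↦ by field_simp; ring
    have e3 : z ^ N * (p ^ (N ^ 2))⁻¹ = ∏ k ∈ Finset.range N, (z * (p ^ (2 * k + 1))⁻¹) := by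
      rw [Finset.prod_mul_distrib, Finset.prod_const, Finset.card_range, Finset.prod_inv_distrib,
        Finset.prod_pow_eq_pow_sum]
      congr 3
      clear h e1
      induction N with
      | zero => simp
      | succ N ih => rw [Finset.sum_range_succ, ← ih]; ring
    rw [e1, e3, mul_assoc]
    refine (mul_comm _ _).trans (congrArg _ ?_)
    rw [← Finset.prod_mul_distrib]
    refine Finset.prod_congr rfl fun k hk ↦ ?_
    have hk := Finset.mem_range.mp hk
    obtain ⟨m, rfl⟩ : ∃ m, N = m + k + 1 := ⟨N - k - 1, by omega⟩
    rw [show m + k + 1 - 1 - k = m by omega]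
    field_simp
    ring
  rw [h1] at h
  have hne : z ^ N * (p ^ (N ^ 2))⁻¹ ≠ 0 := by positivity
  refine mul_right_cancel₀ hne (h.trans ?_)
  rw [Finset.sum_mul]
  refine Finset.sum_congr rfl fun j _ ↦ ?_
  rw [sub_sq, zpow_add₀ hp, zpow_sub₀ hp, zpow_sub₀ hz]
  norm_cast
  rw [mul_pow, inv_pow, ← pow_mul, mul_right_comm 2 j N]
  field_simp

lemma summable_pow_sq_mul_pow {p : ℝ} (hp : 0 < p) (hp1 : p < 1) {w : ℝ} (hw : 0 < w) :
    Summable fun n : ℕ ↦ p ^ (n ^ 2) * w ^ n := by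
  refine summable_of_ratio_test_tendsto_lt_one (l := 0) one_pos
    (Eventually.of_forall fun n ↦ by positivity) ?_
  have h : Tendsto (fun n : ℕ ↦ p * w * (p ^ 2) ^ n) atTop (𝓝 (p * w * 0)) :=
    (tendsto_pow_atTop_nhds_zero_of_lt_one (by positivity) (by nlinarith)).const_mul _
  rw [mul_zero] at h
  refine h.congr fun n ↦ ?_
  rw [Real.norm_of_nonneg (by positivity), Real.norm_of_nonneg (by positivity)]
  field_simp
  ring

lemma summable_zpow_sq_mul_zpow {p : ℝ} (hp : 0 < p) (hp1 : p < 1) {z : ℝ} (hz : z ≠ 0) :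
    Summable fun i : ℤ ↦ p ^ (i ^ 2) * z ^ i := by
  refine Summable.of_norm ?_
  have key : ∀ w : ℝ, 0 < w → Summable fun n : ℕ ↦ p ^ ((n : ℤ) ^ 2) * w ^ (n : ℤ) := fun w hw ↦ by
    convert summable_pow_sq_mul_pow hp hp1 hw using 2 with n
    norm_cast
  simp only [norm_mul, norm_zpow, Real.norm_of_nonneg hp.le]
  refine Summable.of_nat_of_neg (key ‖z‖ (by positivity)) ?_
  refine (key ‖z‖⁻¹ (by positivity)).congr fun n ↦ ?_
  rw [neg_sq, inv_zpow, zpow_neg]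

lemma multipliable_one_add_mul_pow {p : ℝ} (hp : 0 < p) (hp1 : p < 1) (z : ℝ) (a d : ℕ)
    (hd : 0 < d) : Multipliable fun n : ℕ ↦ 1 + z * p ^ (d * n + a) := by
  refine Real.multipliable_one_add_of_summable ?_
  have h : Summable fun n : ℕ ↦ (z * p ^ a) * (p ^ d) ^ n :=
    (summable_geometric_of_lt_one (by positivity) (pow_lt_one₀ hp.le hp1 hd.ne')).mul_left _
  exact h.congr fun n ↦ by ring

/-- The product `(q ^ a; q ^ d)_∞ = ∏_{n ≥ 0} (1 - q ^ (d n + a))`. -/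
noncomputable def pochhammerInf (q : ℝ) (d a : ℕ) : ℝ := ∏' n : ℕ, (1 - q ^ (d * n + a))

lemma multipliable_pochhammerInf {q : ℝ} (hq : 0 < q) (hq1 : q < 1) {d : ℕ} (hd : 0 < d) (a : ℕ) :
    Multipliable fun n : ℕ ↦ 1 - q ^ (d * n + a) :=
  (multipliable_one_add_mul_pow hq hq1 (-1) a d hd).congr fun n ↦ by ring

lemma pochhammerInf_ne_zero {q : ℝ} (hq : 0 < q) (hq1 : q < 1) {d a : ℕ} (hd : 0 < d)
    (ha : 0 < a) : pochhammerInf q d a ≠ 0 := by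
  have h : Summable fun n : ℕ ↦ ‖-q ^ (d * n + a)‖ := by
    have h : Summable fun n : ℕ ↦ q ^ a * (q ^ d) ^ n :=
      (summable_geometric_of_lt_one (by positivity) (pow_lt_one₀ hq.le hq1 hd.ne')).mul_left _
    refine h.congr fun n ↦ ?_
    rw [norm_neg, Real.norm_of_nonneg (by positivity)]
    ring
  have := tprod_one_add_ne_zero_of_summable (f := fun n : ℕ ↦ -q ^ (d * n + a)) (fun n ↦ by
    have := pow_lt_one₀ hq.le hq1 (show d * n + a ≠ 0 by omega)
    linarith) h
  simpa [pochhammerInf, sub_eq_add_neg] using this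

lemma gaussChoose_nonneg {p : ℝ} (hp : 0 ≤ p) (n j : ℕ) : 0 ≤ gaussChoose p n j := by
  induction n generalizing j with
  | zero => cases j <;> simp [gaussChoose]
  | succ n ih => cases j with
    | zero => simp [gaussChoose]
    | succ j => rw [gaussChoose]; have := ih j; have := ih (j + 1); positivity

/-- The Jacobi triple product identity. -/
theorem jacobi_triple_product {p z : ℝ} (hp : 0 < p) (hp1 : p < 1) (hz : z ≠ 0) :
    ∑' i : ℤ, p ^ (i ^ 2) * z ^ i = pochhammerInf p 2 2 *
      ((∏' n : ℕ, (1 + z * p ^ (2 * n + 1))) * ∏' n : ℕ, (1 + z⁻¹ * p ^ (2 * n + 1))) := by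
  set L := pochhammerInf p 2 2 with hL
  have hL0 : L ≠ 0 := pochhammerInf_ne_zero hp hp1 two_pos two_pos
  have hlim : Tendsto (finEuler p) atTop (𝓝 L) :=
    (multipliable_pochhammerInf hp hp1 two_pos 2).tendsto_prod_tprod_nat
  have hfac : ∀ n : ℕ, 0 < 1 - p ^ (2 * n + 2) ∧ 1 - p ^ (2 * n + 2) ≤ 1 := fun n ↦ by
    have := pow_lt_one₀ hp.le hp1 (show 2 * n + 2 ≠ 0 by omega)
    have : 0 < p ^ (2 * n + 2) := by positivity
    constructor <;> linarith
  have hpos : ∀ n, 0 < finEuler p n := fun n ↦ Finset.prod_pos fun i _ ↦ (hfac i).1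
  have hanti : Antitone (finEuler p) := antitone_nat_of_succ_le fun n ↦ by
    rw [finEuler, Finset.prod_range_succ]
    exact mul_le_of_le_one_right (hpos n).le (hfac n).2
  have hle : ∀ n, L ≤ finEuler p n := fun n ↦ hanti.le_of_tendsto hlim n
  have hle1 : ∀ n, finEuler p n ≤ 1 := fun n ↦ by simpa [finEuler] using hanti (Nat.zero_le n)
  have hLpos : 0 < L := lt_of_le_of_ne
    (ge_of_tendsto' hlim fun n ↦ (hpos n).le) hL0.symm
  have hg : ∀ a b, gaussChoose p (a + b) a = finEuler p (a + b) / (finEuler p a * finEuler p b) :=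
    fun a b ↦ by
      rw [eq_div_iff (mul_pos (hpos a) (hpos b)).ne', gaussChoose_add_mul_finEuler]
  have hbound : ∀ n j, ‖gaussChoose p n j‖ ≤ (L * L)⁻¹ := fun n j ↦ by
    rw [Real.norm_of_nonneg (gaussChoose_nonneg hp.le n j)]
    rcases lt_or_ge n j with h | h
    · rw [gaussChoose_eq_zero_of_lt p h]; positivity
    · obtain ⟨b, rfl⟩ := Nat.exists_eq_add_of_le h
      rw [hg, ← one_div]
      exact div_le_div₀ zero_le_one (hle1 _) (by positivity)
        (mul_le_mul (hle _) (hle _) hLpos.le (hpos _).le)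
  let F : ℕ → ℤ → ℝ := fun N i ↦
    if i ∈ Finset.Icc (-(N : ℤ)) N then
      gaussChoose p (2 * N) (N + i).toNat * (p ^ (i ^ 2) * z ^ i) else 0
  have hF : ∀ N, ∑' i, F N i = (∏ k ∈ Finset.range N, (1 + z * p ^ (2 * k + 1))) *
      (∏ k ∈ Finset.range N, (1 + z⁻¹ * p ^ (2 * k + 1))) := fun N ↦ by
    rw [prod_mul_prod_eq_sum p z hp.ne' hz, tsum_eq_sum (s := Finset.Icc (-(N : ℤ)) N)
      (fun i hi ↦ if_neg hi)]
    refine Finset.sum_bij' (fun i _ ↦ (N + i).toNat) (fun j _ ↦ (j : ℤ) - N) ?_ ?_ ?_ ?_ ?_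
    · intro i hi
      simp only [Finset.mem_Icc, Finset.mem_range] at hi ⊢
      omega
    · intro i hi
      simp only [Finset.mem_Icc, Finset.mem_range] at hi ⊢
      omega
    · intro i hi
      simp only [Finset.mem_Icc] at hi ⊢
      omega
    · intro i hi
      omega
    · intro i hi
      simp only [if_pos hi]
      simp only [Finset.mem_Icc] at hi
      rw [show (((N + i).toNat : ℕ) : ℤ) - N = i by omega]
  have h1 : Tendsto (fun N ↦ ∑' i, F N i) atTop (𝓝 (∑' i : ℤ, L⁻¹ * (p ^ (i ^ 2) * z ^ i))) := by
    refine tendsto_tsum_of_dominated_convergence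
      (bound := fun i : ℤ ↦ (L * L)⁻¹ * ‖p ^ (i ^ 2) * z ^ i‖)
      ((summable_zpow_sq_mul_zpow hp hp1 hz).norm.mul_left _) ?_ ?_
    · intro i
      have t1 : Tendsto (fun N : ℕ ↦ (N + i).toNat) atTop atTop :=
        tendsto_atTop_atTop.mpr fun b ↦ ⟨b + i.natAbs, fun N hN ↦ by omega⟩
      have t2 : Tendsto (fun N : ℕ ↦ (N - i).toNat) atTop atTop :=
        tendsto_atTop_atTop.mpr fun b ↦ ⟨b + i.natAbs, fun N hN ↦ by omega⟩
      have t3 : Tendsto (fun N : ℕ ↦ 2 * N) atTop atTop :=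
        tendsto_atTop_atTop.mpr fun b ↦ ⟨b, fun N hN ↦ by omega⟩
      have t := ((hlim.comp t3).div ((hlim.comp t1).mul (hlim.comp t2)) (mul_ne_zero hL0 hL0)).mul_const
        (p ^ (i ^ 2) * z ^ i)
      rw [show L / (L * L) = L⁻¹ by field_simp] at t
      refine t.congr' ?_
      filter_upwards [eventually_ge_atTop i.natAbs] with N hN
      have hi : i ∈ Finset.Icc (-(N : ℤ)) N := by
        simp only [Finset.mem_Icc]
        omega
      simp only [F, if_pos hi, Pi.div_apply, Function.comp_apply]
      have e := hg (N + i).toNat (N - i).toNat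
      rw [show (N + i).toNat + (N - i).toNat = 2 * N by omega] at e
      rw [e]
    · refine Eventually.of_forall fun N i ↦ ?_
      simp only [F]
      split_ifs
      · rw [norm_mul]
        exact mul_le_mul_of_nonneg_right (hbound _ _) (norm_nonneg _)
      · rw [norm_zero]; positivity
  simp only [hF] at h1
  have h2 := ((multipliable_one_add_mul_pow hp hp1 z 1 2 two_pos).tendsto_prod_tprod_nat).mul
    ((multipliable_one_add_mul_pow hp hp1 z⁻¹ 1 2 two_pos).tendsto_prod_tprod_nat)
  have h3 := tendsto_nhds_unique h1 h2
  rw [tsum_mul_left] at h3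
  rw [← h3, mul_inv_cancel_left₀ hL0]

/-- Jacobi's triple product for Ramanujan's theta function `f(ε q ^ s, ε q ^ t)`, where `ε = ± 1` and
`q = p ^ 2`. -/
lemma tsum_theta_eq_prod {p : ℝ} (hp : 0 < p) (hp1 : p < 1) {ε : ℝ} (hε : ε * ε = 1) (s t : ℕ)
    (hst : 0 < s + t) :
    ∑' i : ℤ, ε ^ i * p ^ (((s : ℤ) + t) * i ^ 2 + (s - t) * i) =
      pochhammerInf (p ^ 2) (s + t) (s + t) *
        ((∏' n : ℕ, (1 + ε * (p ^ 2) ^ ((s + t) * n + s))) *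
          ∏' n : ℕ, (1 + ε * (p ^ 2) ^ ((s + t) * n + t))) := by
  have hε0 : ε ≠ 0 := left_ne_zero_of_mul_eq_one hε
  have hinv : ε⁻¹ = ε := inv_eq_of_mul_eq_one_left hε
  have h := jacobi_triple_product (p := p ^ (s + t)) (z := ε * p ^ ((s : ℤ) - t)) (by positivity)
    (pow_lt_one₀ hp.le hp1 hst.ne') (by positivity)
  convert h using 1
  · refine tsum_congr fun i ↦ ?_
    rw [mul_zpow, ← zpow_natCast p, ← zpow_mul, ← zpow_mul, zpow_add₀ hp.ne']
    push_cast
    ring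
  · congr 1
    · refine tprod_congr fun n ↦ ?_
      ring
    · congr 1
      · refine tprod_congr fun n ↦ ?_
        rw [zpow_sub₀ hp.ne']
        field_simp
        norm_cast
        ring
      · refine tprod_congr fun n ↦ ?_
        rw [mul_inv, hinv, zpow_sub₀ hp.ne']
        field_simp
        norm_cast
        ring

lemma summable_norm_theta {p : ℝ} (hp : 0 < p) (hp1 : p < 1) {ε : ℝ} (hε : ε * ε = 1) {c : ℕ}
    (hc : 0 < c) (d : ℤ) : Summable fun i : ℤ ↦ ‖ε ^ i * p ^ (c * i ^ 2 + d * i)‖ := by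
  have hε0 : ε ≠ 0 := left_ne_zero_of_mul_eq_one hε
  refine ((summable_zpow_sq_mul_zpow (p := p ^ c) (z := ε * p ^ d) (by positivity)
    (pow_lt_one₀ hp.le hp1 hc.ne') (by positivity)).norm).congr fun i ↦ ?_
  congr 1
  rw [mul_zpow, ← zpow_natCast p, ← zpow_mul, ← zpow_mul, zpow_add₀ hp.ne']
  ring

lemma tsum_theta_mul_tsum_theta {p : ℝ} (hp : 0 < p) (hp1 : p < 1) {ε δ : ℝ} (hε : ε * ε = 1)
    (hδ : δ * δ = 1) {c c' : ℕ} (hc : 0 < c) (hc' : 0 < c') (d d' : ℤ) :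
    (∑' i : ℤ, ε ^ i * p ^ (c * i ^ 2 + d * i)) * (∑' i : ℤ, δ ^ i * p ^ (c' * i ^ 2 + d' * i)) =
      ∑' x : ℤ × ℤ, ε ^ x.1 * δ ^ x.2 * p ^ (c * x.1 ^ 2 + d * x.1 + c' * x.2 ^ 2 + d' * x.2) := by
  rw [tsum_mul_tsum_of_summable_norm (summable_norm_theta hp hp1 hε hc d)
    (summable_norm_theta hp hp1 hδ hc' d')]
  refine tsum_congr fun x ↦ ?_
  rw [add_assoc (_ + _), zpow_add₀ hp.ne' (_ + _)]
  ring

/-- The decomposition of `ℤ × ℤ` into five cosets of an index-five sublattice. -/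
def latticeEquiv : Fin 5 × (ℤ × ℤ) ≃ ℤ × ℤ where
  toFun x := (2 * x.2.1 + 3 * x.2.2 + (x.1 : ℕ), x.2.1 - x.2.2)
  invFun y := (⟨((y.1 - 2 * y.2) % 5).toNat, by omega⟩,
    (y.2 + (y.1 - 2 * y.2) / 5, (y.1 - 2 * y.2) / 5))
  left_inv := by
    rintro ⟨⟨r, hr⟩, j, k⟩
    simp only [Prod.mk.injEq, Fin.mk.injEq]
    omega
  right_inv := by
    rintro ⟨n, m⟩
    simp only [Prod.mk.injEq]
    omega

lemma neg_one_zpow_sub (j k : ℤ) : (-1 : ℝ) ^ (j - k) = (-1) ^ j * (-1) ^ k := by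
  have h : ((-1 : ℝ) ^ k)⁻¹ = (-1) ^ k := by rw [← inv_zpow]; norm_num
  rw [zpow_sub₀ (by norm_num), div_eq_mul_inv, h]

lemma tsum_theta_dissection {p : ℝ} (hp : 0 < p) (hp1 : p < 1) :
    ∑' x : ℤ × ℤ, (-1 : ℝ) ^ x.2 * p ^ (x.1 ^ 2 + x.1 + 6 * x.2 ^ 2) =
      2 * (∑' x : ℤ × ℤ, (-1 : ℝ) ^ x.1 * (-1) ^ x.2 *
          p ^ (10 * x.1 ^ 2 + 2 * x.1 + 15 * x.2 ^ 2 + 3 * x.2) +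
        p ^ 2 * ∑' x : ℤ × ℤ, (-1 : ℝ) ^ x.1 * (-1) ^ x.2 *
          p ^ (10 * x.1 ^ 2 + 6 * x.1 + 15 * x.2 ^ 2 + 9 * x.2)) := by
  set F : ℤ × ℤ → ℝ := fun x ↦ (-1 : ℝ) ^ x.2 * p ^ (x.1 ^ 2 + x.1 + 6 * x.2 ^ 2) with hF
  set T : ℕ → ℝ := fun r ↦ ∑' x : ℤ × ℤ, F (2 * x.1 + 3 * x.2 + r, x.1 - x.2) with hT
  have hsum : Summable F := by
    refine (summable_mul_of_summable_norm
      (summable_norm_theta hp hp1 (one_mul 1) one_pos 1)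
      (summable_norm_theta hp hp1 (show (-1 : ℝ) * -1 = 1 by norm_num)
        (show 0 < 6 by norm_num) 0)).congr fun x ↦ ?_
    simp only [hF]
    rw [zpow_add₀ hp.ne' (x.1 ^ 2 + x.1)]
    simp
    ring
  have hsplit : ∑' x, F x = T 0 + T 1 + T 2 + T 3 + T 4 := by
    have hs := latticeEquiv.summable_iff.mpr hsum
    rw [← latticeEquiv.tsum_eq F]
    refine hs.tsum_prod.trans ?_
    rw [tsum_fintype]
    simp [Fin.sum_univ_five, hT, latticeEquiv]
  let refl : ℤ × ℤ ≃ ℤ × ℤ := (Equiv.subLeft (-1)).prodCongr (Equiv.subLeft (-1))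
  have hsymm : ∀ r s : ℕ, r + s = 4 → T r = T s := fun r s h ↦ by
    have h' : (r : ℤ) = 4 - s := by omega
    simp only [hT]
    rw [← refl.tsum_eq]
    refine tsum_congr fun x ↦ ?_
    simp only [refl, Equiv.prodCongr_apply, Prod.map, Equiv.subLeft_apply, hF, h']
    rw [neg_one_zpow_sub, neg_one_zpow_sub, neg_one_zpow_sub, neg_one_zpow_sub]
    have e : (-1 : ℝ) ^ (-1 : ℤ) = -1 := by norm_num
    rw [e]
    congr 1
    · ring
    · congr 1; ring
  have hT2 : T 2 = 0 := by
    have h : T 2 = - T 2 := by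
      conv_lhs => simp only [hT]
      rw [← ((Equiv.subLeft (-1 : ℤ)).prodCongr (Equiv.refl ℤ)).tsum_eq, hT, ← tsum_neg]
      refine tsum_congr fun x ↦ ?_
      simp only [Equiv.prodCongr_apply, Prod.map, Equiv.subLeft_apply, hF, Equiv.refl_apply]
      rw [neg_one_zpow_sub, neg_one_zpow_sub, neg_one_zpow_sub, ← neg_mul]
      have e : (-1 : ℝ) ^ (-1 : ℤ) = -1 := by norm_num
      rw [e]
      congr 1
      · ring
      · congr 1; push_cast; ring
    linarith
  have hT0 : T 0 = ∑' x : ℤ × ℤ, (-1 : ℝ) ^ x.1 * (-1) ^ x.2 *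
          p ^ (10 * x.1 ^ 2 + 2 * x.1 + 15 * x.2 ^ 2 + 3 * x.2) := by
    refine tsum_congr fun x ↦ ?_
    simp only [hF, neg_one_zpow_sub]
    congr 2
    push_cast
    ring
  have hT1 : T 1 = p ^ 2 * ∑' x : ℤ × ℤ, (-1 : ℝ) ^ x.1 * (-1) ^ x.2 *
          p ^ (10 * x.1 ^ 2 + 6 * x.1 + 15 * x.2 ^ 2 + 9 * x.2) := by
    rw [← tsum_mul_left]
    refine tsum_congr fun x ↦ ?_
    simp only [hF, neg_one_zpow_sub]
    rw [mul_left_comm, ← zpow_natCast p 2, ← zpow_add₀ hp.ne']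
    congr 2
    push_cast
    ring
  rw [hsplit, ← hT0, ← hT1, hsymm 4 0 rfl, hsymm 3 1 rfl, hT2]
  ring

lemma prod_range_mul_eq (f : ℕ → ℝ) (k N : ℕ) :
    ∏ i ∈ Finset.range (k * N), f i = ∏ r ∈ Finset.range k, ∏ n ∈ Finset.range N, f (k * n + r) := by
  induction N with
  | zero => simp
  | succ N ih =>
    rw [Nat.mul_succ, Finset.prod_range_add, ih, ← Finset.prod_mul_distrib]
    simp only [Finset.prod_range_succ]

lemma pochhammerInf_eq_prod {q : ℝ} (hq : 0 < q) (hq1 : q < 1) {d k : ℕ} (hd : 0 < d) (hk : 0 < k)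
    (a : ℕ) : pochhammerInf q d a = ∏ r ∈ Finset.range k, pochhammerInf q (d * k) (d * r + a) := by
  have h1 := (multipliable_pochhammerInf hq hq1 hd a).tendsto_prod_tprod_nat.comp
    (tendsto_id.const_mul_atTop' hk)
  have h2 : Tendsto (fun N ↦ ∏ r ∈ Finset.range k, ∏ n ∈ Finset.range N,
      (1 - q ^ (d * k * n + (d * r + a)))) atTop
      (𝓝 (∏ r ∈ Finset.range k, pochhammerInf q (d * k) (d * r + a))) :=
    tendsto_finsetProd _ fun r _ ↦
      (multipliable_pochhammerInf hq hq1 (Nat.mul_pos hd hk) _).tendsto_prod_tprod_nat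
  refine tendsto_nhds_unique h1 (h2.congr fun N ↦ ?_)
  simp only [Function.comp_apply, id, prod_range_mul_eq]
  refine Finset.prod_congr rfl fun r _ ↦ Finset.prod_congr rfl fun n _ ↦ ?_
  ring

lemma pochhammerInf_mul_tprod_one_add {q : ℝ} (hq : 0 < q) (hq1 : q < 1) :
    pochhammerInf q 1 1 * ∏' n : ℕ, (1 + q ^ (n + 1)) = pochhammerInf q 2 2 := by
  have h : Multipliable fun n : ℕ ↦ 1 + q ^ (n + 1) :=
    (multipliable_one_add_mul_pow hq hq1 1 1 1 one_pos).congr fun n ↦ by simp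
  rw [pochhammerInf, pochhammerInf, ← (multipliable_pochhammerInf hq hq1 one_pos 1).tprod_mul h]
  exact tprod_congr fun n ↦ by ring

lemma theta_identity {q : ℝ} (hq : 0 < q) (hq1 : q < 1) :
    pochhammerInf q 1 1 * (∏' n : ℕ, (1 + q ^ (n + 1))) ^ 2 *
      (pochhammerInf q 6 6 * pochhammerInf q 6 3 ^ 2) =
    pochhammerInf q 10 10 * pochhammerInf q 10 6 * pochhammerInf q 10 4 *
      (pochhammerInf q 15 15 * pochhammerInf q 15 9 * pochhammerInf q 15 6) +
    q * (pochhammerInf q 10 10 * pochhammerInf q 10 8 * pochhammerInf q 10 2 *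
      (pochhammerInf q 15 15 * pochhammerInf q 15 12 * pochhammerInf q 15 3)) := by
  obtain ⟨p, hp, hp1, rfl⟩ : ∃ p : ℝ, 0 < p ∧ p < 1 ∧ q = p ^ 2 :=
    ⟨√q, Real.sqrt_pos.mpr hq, by rwa [Real.sqrt_lt' one_pos, one_pow], (Real.sq_sqrt hq.le).symm⟩
  have hm : (-1 : ℝ) * -1 = 1 := by norm_num
  have key := tsum_theta_dissection hp hp1
  have e0 := tsum_theta_mul_tsum_theta hp hp1 (one_mul (1 : ℝ)) hm (c := 1) (c' := 6)
    (by norm_num) (by norm_num) 1 0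
  have e1 := tsum_theta_mul_tsum_theta hp hp1 hm hm (c := 10) (c' := 15)
    (by norm_num) (by norm_num) 2 3
  have e2 := tsum_theta_mul_tsum_theta hp hp1 hm hm (c := 10) (c' := 15)
    (by norm_num) (by norm_num) 6 9
  have hneg : ∀ d a : ℕ, ∏' n : ℕ, (1 + -1 * (p ^ 2) ^ (d * n + a)) = pochhammerInf (p ^ 2) d a :=
    fun d a ↦ tprod_congr fun n ↦ by ring
  have t0 := tsum_theta_eq_prod hp hp1 (one_mul (1 : ℝ)) 1 0 (by norm_num)
  have t1 := tsum_theta_eq_prod hp hp1 hm 3 3 (by norm_num)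
  have t2 := tsum_theta_eq_prod hp hp1 hm 6 4 (by norm_num)
  have t3 := tsum_theta_eq_prod hp hp1 hm 9 6 (by norm_num)
  have t4 := tsum_theta_eq_prod hp hp1 hm 8 2 (by norm_num)
  have t5 := tsum_theta_eq_prod hp hp1 hm 12 3 (by norm_num)
  simp only [hneg] at t1 t2 t3 t4 t5
  have hz : ∏' n : ℕ, (1 + (p ^ 2) ^ n) = 2 * ∏' n : ℕ, (1 + (p ^ 2) ^ (n + 1)) := by
    rw [tprod_eq_zero_mul' ((multipliable_one_add_mul_pow hq hq1 1 1 1 one_pos).congr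
      fun n ↦ by simp)]
    norm_num
  norm_num at t0 t1 t2 t3 t4 t5 e0 e1 e2 key
  rw [hz] at t0
  rw [t0, t1] at e0
  rw [t2, t3] at e1
  rw [t4, t5] at e2
  rw [← e0, ← e1, ← e2] at key
  linear_combination key / 2

lemma tprod_inv_eq {ι : Type*} {f : ι → ℝ} (hf : Multipliable f) (h : ∏' i, f i ≠ 0) :
    ∏' i, (f i)⁻¹ = (∏' i, f i)⁻¹ :=
  (hf.hasProd.inv₀ h).tprod_eq

theorem ramanujan_identity_integer_exponents (q : ℝ) (hq0 : 0 < q) (hq1 : q < 1) :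
    (∏' n : ℕ, ((1 - q ^ (6 * n + 1)) * (1 - q ^ (6 * n + 5)))⁻¹) =
      (∏' n : ℕ, ((1 - q ^ (10 * n + 2)) * (1 - q ^ (10 * n + 8)) *
        (1 - q ^ (15 * n + 3)) * (1 - q ^ (15 * n + 12)))⁻¹) +
      q * ∏' n : ℕ, ((1 - q ^ (10 * n + 4)) * (1 - q ^ (10 * n + 6)) *
        (1 - q ^ (15 * n + 6)) * (1 - q ^ (15 * n + 9)))⁻¹ := by
  have hm : ∀ d a : ℕ, 0 < d → Multipliable fun n : ℕ ↦ 1 - q ^ (d * n + a) :=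
    fun d a hd ↦ multipliable_pochhammerInf hq0 hq1 hd a
  have hne : ∀ d a : ℕ, 0 < d → 0 < a → pochhammerInf q d a ≠ 0 :=
    fun d a ↦ pochhammerInf_ne_zero hq0 hq1
  have two : ∀ d a b : ℕ, 0 < d → 0 < a → 0 < b →
      ∏' n : ℕ, ((1 - q ^ (d * n + a)) * (1 - q ^ (d * n + b)))⁻¹ =
        (pochhammerInf q d a * pochhammerInf q d b)⁻¹ := fun d a b hd ha hb ↦ by
    have h := (hm d a hd).tprod_mul (hm d b hd)
    rw [tprod_inv_eq ((hm d a hd).mul (hm d b hd)) (by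
      rw [h]; exact mul_ne_zero (hne d a hd ha) (hne d b hd hb)), h]
    rfl
  have four : ∀ d a b e s t : ℕ, 0 < d → 0 < a → 0 < b → 0 < e → 0 < s → 0 < t →
      ∏' n : ℕ, ((1 - q ^ (d * n + a)) * (1 - q ^ (d * n + b)) * (1 - q ^ (e * n + s)) *
        (1 - q ^ (e * n + t)))⁻¹ = (pochhammerInf q d a * pochhammerInf q d b *
          pochhammerInf q e s * pochhammerInf q e t)⁻¹ := fun d a b e s t hd ha hb he hs ht ↦ by
    have m2 := (hm d a hd).mul (hm d b hd)
    have m3 := m2.mul (hm e s he)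
    have h : ∏' n : ℕ, ((1 - q ^ (d * n + a)) * (1 - q ^ (d * n + b)) * (1 - q ^ (e * n + s)) *
        (1 - q ^ (e * n + t))) = pochhammerInf q d a * pochhammerInf q d b *
          pochhammerInf q e s * pochhammerInf q e t := by
      rw [m3.tprod_mul (hm e t he), m2.tprod_mul (hm e s he), (hm d a hd).tprod_mul (hm d b hd)]
      rfl
    rw [tprod_inv_eq (m3.mul (hm e t he)) (by
      rw [h]
      exact mul_ne_zero (mul_ne_zero (mul_ne_zero (hne d a hd ha) (hne d b hd hb))
        (hne e s he hs)) (hne e t he ht)), h]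
  rw [two, four, four] <;> try norm_num
  have key := theta_identity hq0 hq1
  have hM := pochhammerInf_mul_tprod_one_add hq0 hq1
  have s11 := pochhammerInf_eq_prod hq0 hq1 (d := 1) (k := 2) (by norm_num) (by norm_num) 1
  have s21 := pochhammerInf_eq_prod hq0 hq1 (d := 2) (k := 3) (by norm_num) (by norm_num) 1
  have s33 := pochhammerInf_eq_prod hq0 hq1 (d := 3) (k := 2) (by norm_num) (by norm_num) 3
  have s33' := pochhammerInf_eq_prod hq0 hq1 (d := 3) (k := 5) (by norm_num) (by norm_num) 3
  have s22 := pochhammerInf_eq_prod hq0 hq1 (d := 2) (k := 5) (by norm_num) (by norm_num) 2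
  norm_num [Finset.prod_range_succ] at s11 s21 s33 s33' s22
  have n22 := hne 2 2 (by norm_num) (by norm_num)
  have n61 := hne 6 1 (by norm_num) (by norm_num)
  have n65 := hne 6 5 (by norm_num) (by norm_num)
  have n33 := hne 3 3 (by norm_num) (by norm_num)
  have n2 := hne 10 2 (by norm_num) (by norm_num)
  have n4 := hne 10 4 (by norm_num) (by norm_num)
  have n6 := hne 10 6 (by norm_num) (by norm_num)
  have n8 := hne 10 8 (by norm_num) (by norm_num)
  have m3 := hne 15 3 (by norm_num) (by norm_num)
  have m6 := hne 15 6 (by norm_num) (by norm_num)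
  have m9 := hne 15 9 (by norm_num) (by norm_num)
  have m12 := hne 15 12 (by norm_num) (by norm_num)
  set M := ∏' n : ℕ, (1 + q ^ (n + 1))
  have hM1 : pochhammerInf q 6 1 * pochhammerInf q 6 3 * pochhammerInf q 6 5 * M = 1 := by
    rw [s11, s21] at hM
    refine mul_right_cancel₀ n22 ?_
    linear_combination hM
  have hL : pochhammerInf q 6 1 * pochhammerInf q 6 5 * (pochhammerInf q 1 1 * M ^ 2 *
      (pochhammerInf q 6 6 * pochhammerInf q 6 3 ^ 2)) =
      pochhammerInf q 2 2 * pochhammerInf q 3 3 := by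
    rw [← hM, s33]
    linear_combination (pochhammerInf q 1 1 * M * pochhammerInf q 6 6 * pochhammerInf q 6 3) * hM1
  rw [key] at hL
  have hX : (pochhammerInf q 6 1 * pochhammerInf q 6 5)⁻¹ =
      (pochhammerInf q 10 10 * pochhammerInf q 10 6 * pochhammerInf q 10 4 *
      (pochhammerInf q 15 15 * pochhammerInf q 15 9 * pochhammerInf q 15 6) +
    q * (pochhammerInf q 10 10 * pochhammerInf q 10 8 * pochhammerInf q 10 2 *
      (pochhammerInf q 15 15 * pochhammerInf q 15 12 * pochhammerInf q 15 3))) /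
      (pochhammerInf q 2 2 * pochhammerInf q 3 3) := by
    rw [eq_div_iff (mul_ne_zero n22 n33), ← hL]
    field_simp
  have n10 := hne 10 10 (by norm_num) (by norm_num)
  have m15 := hne 15 15 (by norm_num) (by norm_num)
  rw [← mul_inv, mul_comm (pochhammerInf q 6 5)]
  rw [hX, s22, s33']
  field_simp
end

section
/- For every real number q with 0 < q < 1: Σ_{m∈ℤ} ( q^{30m² − 4m} − q^{30m² + 16m + 2} + q^{30m² − 14m + 3/2} − q^{30m² + 26m + 11/2} ) = (q)_∞ / ∏_{n=0}^∞ ((1 − q^{(5n+2)/2})(1 − q^{(5n+3)/2})). -/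
open scoped BigOperators

open Filter Topology Finset

/-- The infinite `q`-Pochhammer symbol `(c; r)_∞ = ∏_{n ≥ 0} (1 - c r ^ n)`. -/
noncomputable def qPoch (c r : ℝ) : ℝ := ∏' n : ℕ, (1 - c * r ^ n)

lemma summable_norm_neg_mul_pow (c : ℝ) {r : ℝ} (hr : |r| < 1) :
    Summable fun n : ℕ ↦ ‖-(c * r ^ n)‖ := by
  simpa only [norm_neg, norm_mul, norm_pow, Real.norm_eq_abs] using
    (summable_geometric_of_lt_one (abs_nonneg r) hr).mul_left |c|

lemma multipliable_qPoch (c : ℝ) {r : ℝ} (hr : |r| < 1) :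
    Multipliable fun n : ℕ ↦ 1 - c * r ^ n := by
  simpa only [sub_eq_add_neg] using
    multipliable_one_add_of_summable (summable_norm_neg_mul_pow c hr)

lemma tendsto_qPoch (c : ℝ) {r : ℝ} (hr : |r| < 1) :
    Tendsto (fun N : ℕ ↦ ∏ i ∈ range N, (1 - c * r ^ i)) atTop (𝓝 (qPoch c r)) :=
  (multipliable_qPoch c hr).tendsto_prod_tprod_nat

lemma qPoch_ne_zero {c r : ℝ} (hc : |c| < 1) (hr : |r| < 1) : qPoch c r ≠ 0 := by
  have h := tprod_one_add_ne_zero_of_summable (f := fun n : ℕ ↦ -(c * r ^ n)) (fun n h0 ↦ ?_)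
    (summable_norm_neg_mul_pow c hr)
  · simpa only [qPoch, sub_eq_add_neg] using h
  · have h1 : |c * r ^ n| < 1 := by
      rw [abs_mul, abs_pow]
      exact (mul_le_of_le_one_right (abs_nonneg c)
        (pow_le_one₀ (abs_nonneg r) hr.le)).trans_lt hc
    linarith [(abs_lt.mp h1).2]

lemma qPoch_split (c : ℝ) {r : ℝ} (hr : |r| < 1) {k : ℕ} (hk : k ≠ 0) :
    qPoch c r = ∏ i ∈ range k, qPoch (c * r ^ i) (r ^ k) := by
  have hrk : |r ^ k| < 1 := by
    rw [abs_pow]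
    exact pow_lt_one₀ (abs_nonneg r) hr hk
  have h1 := (tendsto_qPoch c hr).comp (tendsto_id.const_mul_atTop' (Nat.pos_of_ne_zero hk))
  have h2 := tendsto_finsetProd (range k) fun i _ ↦ tendsto_qPoch (c * r ^ i) hrk
  refine tendsto_nhds_unique h1 (h2.congr fun N ↦ ?_)
  simp only [Function.comp_apply, id_eq]
  induction N with
  | zero => simp
  | succ N ih =>
    simp only [prod_range_succ, prod_mul_distrib, ih]
    rw [Nat.mul_succ, prod_range_add]
    congr 1
    refine prod_congr rfl fun i _ ↦ ?_
    ring

lemma qPoch_mul_qPoch_neg (c : ℝ) {r : ℝ} (hr : |r| < 1) :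
    qPoch c r * qPoch (-c) r = qPoch (c ^ 2) (r ^ 2) := by
  rw [qPoch, qPoch, ← (multipliable_qPoch c hr).tprod_mul (multipliable_qPoch (-c) hr), qPoch]
  exact tprod_congr fun n ↦ by ring

/-- The finite `q`-factorial `(p; p)_n`. -/
noncomputable def qFac (p : ℝ) (n : ℕ) : ℝ := ∏ i ∈ range n, (1 - p * p ^ i)

/-- The reciprocal of `(p; p)_n`, extended by zero to negative `n`. -/
noncomputable def invQFac (p : ℝ) (n : ℤ) : ℝ := if n < 0 then 0 else (qFac p n.toNat)⁻¹

section

variable {p : ℝ}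

lemma one_sub_mul_pow_mem (hp0 : 0 < p) (hp1 : p < 1) (i : ℕ) :
    0 < 1 - p * p ^ i ∧ 1 - p * p ^ i ≤ 1 := by
  have h : p * p ^ i < 1 := by
    rw [← pow_succ']
    exact pow_lt_one₀ hp0.le hp1 i.succ_ne_zero
  have h' : 0 < p * p ^ i := by positivity
  constructor <;> linarith

lemma qFac_pos (hp0 : 0 < p) (hp1 : p < 1) (n : ℕ) : 0 < qFac p n :=
  prod_pos fun i _ ↦ (one_sub_mul_pow_mem hp0 hp1 i).1

lemma qFac_le_one (hp0 : 0 < p) (hp1 : p < 1) (n : ℕ) : qFac p n ≤ 1 :=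
  prod_le_one (fun i _ ↦ (one_sub_mul_pow_mem hp0 hp1 i).1.le)
    fun i _ ↦ (one_sub_mul_pow_mem hp0 hp1 i).2

lemma abs_lt_one_of_pos (hp0 : 0 < p) (hp1 : p < 1) : |p| < 1 := by
  rwa [abs_of_pos hp0]

lemma tendsto_qFac (hp0 : 0 < p) (hp1 : p < 1) :
    Tendsto (qFac p) atTop (𝓝 (qPoch p p)) :=
  tendsto_qPoch p (abs_lt_one_of_pos hp0 hp1)

lemma qPoch_self_le_qFac (hp0 : 0 < p) (hp1 : p < 1) (n : ℕ) : qPoch p p ≤ qFac p n := by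
  refine Antitone.le_of_tendsto (antitone_nat_of_succ_le fun n ↦ ?_) (tendsto_qFac hp0 hp1) n
  rw [qFac, prod_range_succ]
  exact mul_le_of_le_one_right (qFac_pos hp0 hp1 n).le (one_sub_mul_pow_mem hp0 hp1 n).2

lemma qPoch_self_pos (hp0 : 0 < p) (hp1 : p < 1) : 0 < qPoch p p :=
  have hp := abs_lt_one_of_pos hp0 hp1
  (ge_of_tendsto' (tendsto_qFac hp0 hp1) fun n ↦ (qFac_pos hp0 hp1 n).le).lt_of_ne'
    (qPoch_ne_zero hp hp)

lemma invQFac_nonneg (hp0 : 0 < p) (hp1 : p < 1) (n : ℤ) : 0 ≤ invQFac p n := by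
  rw [invQFac]
  split_ifs
  · rfl
  · exact inv_nonneg.mpr (qFac_pos hp0 hp1 _).le

lemma invQFac_le (hp0 : 0 < p) (hp1 : p < 1) (n : ℤ) : invQFac p n ≤ (qPoch p p)⁻¹ := by
  have h := qPoch_self_pos hp0 hp1
  rw [invQFac]
  split_ifs
  · exact (inv_pos.mpr h).le
  · exact inv_anti₀ h (qPoch_self_le_qFac hp0 hp1 _)

lemma tendsto_invQFac (hp0 : 0 < p) (hp1 : p < 1) :
    Tendsto (invQFac p) atTop (𝓝 (qPoch p p)⁻¹) := by
  have h := (tendsto_qFac hp0 hp1).inv₀ (qPoch_self_pos hp0 hp1).ne'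
  have ht : Tendsto Int.toNat atTop atTop :=
    tendsto_atTop_atTop.mpr fun b ↦ ⟨b, fun a ha ↦ by omega⟩
  refine (h.comp ht).congr' ?_
  filter_upwards [eventually_ge_atTop 0] with n hn
  simp [invQFac, not_lt.mpr hn]

lemma one_sub_zpow_mul_invQFac (hp0 : 0 < p) (hp1 : p < 1) (n : ℤ) :
    (1 - p ^ n) * invQFac p n = invQFac p (n - 1) := by
  rcases lt_trichotomy n 0 with hn | rfl | hn
  · simp [invQFac, hn, show n - 1 < 0 by omega]
  · simp [invQFac]
  · obtain ⟨m, rfl⟩ : ∃ m : ℕ, n = m + 1 := ⟨(n - 1).toNat, by omega⟩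
    have h1 := (one_sub_mul_pow_mem hp0 hp1 m).1.ne'
    have h2 := (qFac_pos hp0 hp1 m).ne'
    have h3 : qFac p (m + 1) = qFac p m * (1 - p * p ^ m) := prod_range_succ _ _
    have h4 : ¬ ((m : ℤ) + 1 < 0) := by omega
    have h5 : ¬ ((m : ℤ) < 0) := by omega
    have h6 : ((m : ℤ) + 1).toNat = m + 1 := by omega
    simp only [invQFac, h4, h5, h6, h3, if_false, add_sub_cancel_right, Int.toNat_natCast]
    rw [show p ^ ((m : ℤ) + 1) = p * p ^ m by rw [zpow_add_one₀ hp0.ne', zpow_natCast, mul_comm]]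
    field_simp

end

/-- The `k`-th Laurent coefficient (times `w ^ k`) of the `N`-th partial Jacobi product. -/
noncomputable def jacobiTerm (Q w : ℝ) (N : ℕ) (k : ℤ) : ℝ :=
  qFac (Q ^ 2) (2 * N) * invQFac (Q ^ 2) (N - k) * invQFac (Q ^ 2) (N + k) * (Q ^ (k ^ 2) * w ^ k)

lemma jacobiTerm_succ {Q w : ℝ} (hQ0 : 0 < Q) (hQ1 : Q < 1) (hw : w ≠ 0) (N : ℕ) (k : ℤ) :
    jacobiTerm Q w (N + 1) k = (1 + (Q * (Q ^ 2) ^ N) ^ 2) * jacobiTerm Q w N k +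
      (Q * (Q ^ 2) ^ N) *
        (w * jacobiTerm Q w N (k - 1) + w⁻¹ * jacobiTerm Q w N (k + 1)) := by
  have hp0 : 0 < Q ^ 2 := by positivity
  have hp1 : Q ^ 2 < 1 := pow_lt_one₀ hQ0.le hQ1 two_ne_zero
  have hQ := hQ0.ne'
  have e (n m : ℤ) (h : m = n - 1) := h ▸ (one_sub_zpow_mul_invQFac hp0 hp1 n).symm
  have u1 := e (N + 1 - k) (N - k) (by ring)
  have u2 := e (N - k) (N - (k + 1)) (by ring)
  have v1 := e (N + 1 + k) (N + k) (by ring)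
  have v2 := e (N + k) (N + (k - 1)) (by ring)
  have hf : qFac (Q ^ 2) (2 * (N + 1)) = qFac (Q ^ 2) (2 * N) *
      (1 - Q ^ 2 * (Q ^ 2) ^ (2 * N)) * (1 - Q ^ 2 * (Q ^ 2) ^ (2 * N + 1)) := by
    rw [qFac, mul_add_one, prod_range_succ, prod_range_succ, ← qFac]
  have u3 : (N : ℤ) - (k - 1) = N + 1 - k := by ring
  have v3 : (N : ℤ) + (k + 1) = N + 1 + k := by ring
  simp only [jacobiTerm, u3, v3, u2, v2, u1, v1, hf]
  push_cast
  have s1 : Q ^ ((k - 1) ^ 2) = Q ^ (k ^ 2) * (Q ^ k)⁻¹ ^ 2 * Q := by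
    rw [← zpow_neg, ← zpow_natCast, ← zpow_mul, ← zpow_add₀ hQ, ← zpow_add_one₀ hQ]
    congr 1
    push_cast
    ring
  have s2 : Q ^ ((k + 1) ^ 2) = Q ^ (k ^ 2) * (Q ^ k) ^ 2 * Q := by
    rw [← zpow_natCast, ← zpow_mul, ← zpow_add₀ hQ, ← zpow_add_one₀ hQ]
    congr 1
    push_cast
    ring
  have z (n : ℤ) : (Q ^ 2) ^ n = (Q ^ n) ^ 2 := by
    rw [← zpow_natCast, ← zpow_natCast, ← zpow_mul, ← zpow_mul, mul_comm]
  rw [s1, s2, zpow_sub_one₀ hw, zpow_add_one₀ hw]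
  simp only [z, zpow_add₀ hQ, zpow_sub₀ hQ, zpow_natCast, zpow_one]
  have hB : Q ^ k ≠ 0 := zpow_ne_zero k hQ
  have t1 : (Q ^ 2) ^ N = (Q ^ N) ^ 2 := by ring
  have t2 : (Q ^ 2) ^ (2 * N) = (Q ^ N) ^ 4 := by ring
  have t3 : (Q ^ 2) ^ (2 * N + 1) = (Q ^ N) ^ 4 * Q ^ 2 := by ring
  rw [t1, t2, t3]
  generalize Q ^ k = B at hB ⊢
  generalize Q ^ N = A
  generalize Q ^ (k ^ 2) = S
  generalize invQFac (Q ^ 2) (N + 1 - k) = u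
  generalize invQFac (Q ^ 2) (N + 1 + k) = v
  generalize qFac (Q ^ 2) _ = f
  field_simp
  ring

lemma hasSum_jacobiTerm {Q w : ℝ} (hQ0 : 0 < Q) (hQ1 : Q < 1) (hw : w ≠ 0) (N : ℕ) :
    HasSum (jacobiTerm Q w N)
      ((∏ i ∈ range N, (1 - -(w * Q) * (Q ^ 2) ^ i)) *
        ∏ i ∈ range N, (1 - -(w⁻¹ * Q) * (Q ^ 2) ^ i)) := by
  induction N with
  | zero =>
    have h := hasSum_single (f := jacobiTerm Q w 0) 0 fun k hk ↦ by
      rcases lt_or_gt_of_ne hk with h | h <;> simp [jacobiTerm, invQFac, h]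
    simpa [jacobiTerm, invQFac, qFac] using h
  | succ N ih =>
    have h1 := (Equiv.subRight (1 : ℤ)).hasSum_iff.mpr ih
    have h2 := (Equiv.addRight (1 : ℤ)).hasSum_iff.mpr ih
    have h := (ih.mul_left (1 + (Q * (Q ^ 2) ^ N) ^ 2)).add
      (((h1.mul_left w).add (h2.mul_left w⁻¹)).mul_left (Q * (Q ^ 2) ^ N))
    rw [funext (jacobiTerm_succ hQ0 hQ1 hw N)]
    refine (congrArg (fun a ↦ HasSum _ a) ?_).mpr h
    rw [prod_range_succ, prod_range_succ]
    field_simp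
    ring

lemma summable_zpow_sq_mul_zpow_s9 {Q : ℝ} (hQ0 : 0 < Q) (hQ1 : Q < 1) {w : ℝ} (hw : w ≠ 0) :
    Summable fun k : ℤ ↦ ‖Q ^ (k ^ 2) * w ^ k‖ := by
  have hT : 0 < -Real.log Q / Real.pi := div_pos (neg_pos.mpr (Real.log_neg hQ0 hQ1)) Real.pi_pos
  refine (summable_pow_mul_jacobiTheta₂_term_bound (|Real.log w| / (2 * Real.pi)) hT
    0).of_nonneg_of_le (fun k ↦ norm_nonneg _) fun k ↦ ?_
  have hk : ‖Q ^ (k ^ 2) * w ^ k‖ =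
      Real.exp (Real.log Q * (k : ℝ) ^ 2 + Real.log w * k) := by
    rw [norm_mul, norm_zpow, norm_zpow, Real.norm_eq_abs, Real.norm_eq_abs, abs_of_pos hQ0,
      ← Real.rpow_intCast, ← Real.rpow_intCast, Real.rpow_def_of_pos hQ0,
      Real.rpow_def_of_pos (abs_pos.mpr hw), Real.log_abs, Real.exp_add]
    push_cast
    rfl
  rw [hk, pow_zero, one_mul, Real.exp_le_exp]
  have h : Real.log w * k ≤ |Real.log w| * |(k : ℝ)| := by
    rw [← abs_mul]
    exact le_abs_self _
  have hpi := Real.pi_pos.ne'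
  push_cast
  calc _ ≤ Real.log Q * (k : ℝ) ^ 2 + |Real.log w| * |(k : ℝ)| := by linarith
    _ = _ := by field_simp; ring

/-- The Jacobi triple product identity. -/
theorem jacobi_triple_product_s9 {Q w : ℝ} (hQ0 : 0 < Q) (hQ1 : Q < 1) (hw : w ≠ 0) :
    ∑' k : ℤ, Q ^ (k ^ 2) * w ^ k =
      qPoch (Q ^ 2) (Q ^ 2) * qPoch (-(w * Q)) (Q ^ 2) * qPoch (-(w⁻¹ * Q)) (Q ^ 2) := by
  have hp0 : 0 < Q ^ 2 := by positivity
  have hp1 : Q ^ 2 < 1 := pow_lt_one₀ hQ0.le hQ1 two_ne_zero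
  have hp := abs_lt_one_of_pos hp0 hp1
  have hpos := qPoch_self_pos hp0 hp1
  set P := qPoch (Q ^ 2) (Q ^ 2)
  have hlim (k : ℤ) : Tendsto (fun N ↦ jacobiTerm Q w N k) atTop
      (𝓝 (P * P⁻¹ * P⁻¹ * (Q ^ (k ^ 2) * w ^ k))) := by
    have h0 : Tendsto (fun N : ℕ ↦ 2 * N) atTop atTop :=
      tendsto_id.const_mul_atTop' two_pos
    have h1 : Tendsto (fun N : ℕ ↦ (N : ℤ) - k) atTop atTop :=
      tendsto_atTop_add_const_right _ _ tendsto_natCast_atTop_atTop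
    have h2 : Tendsto (fun N : ℕ ↦ (N : ℤ) + k) atTop atTop :=
      tendsto_atTop_add_const_right _ _ tendsto_natCast_atTop_atTop
    exact ((((tendsto_qFac hp0 hp1).comp h0).mul ((tendsto_invQFac hp0 hp1).comp h1)).mul
      ((tendsto_invQFac hp0 hp1).comp h2)).mul_const _
  have hbound (N : ℕ) (k : ℤ) :
      ‖jacobiTerm Q w N k‖ ≤ 1 * P⁻¹ * P⁻¹ * ‖Q ^ (k ^ 2) * w ^ k‖ := by
    have i1 := invQFac_nonneg hp0 hp1 (N - k)
    have i2 := invQFac_nonneg hp0 hp1 (N + k)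
    have i3 := (qFac_pos hp0 hp1 (2 * N)).le
    rw [jacobiTerm, norm_mul, Real.norm_of_nonneg (by positivity)]
    gcongr
    · exact qFac_le_one hp0 hp1 _
    · exact invQFac_le hp0 hp1 _
    · exact invQFac_le hp0 hp1 _
  have h := tendsto_tsum_of_dominated_convergence
    ((summable_zpow_sq_mul_zpow_s9 hQ0 hQ1 hw).mul_left (1 * P⁻¹ * P⁻¹)) hlim
    (Eventually.of_forall hbound)
  simp only [(hasSum_jacobiTerm hQ0 hQ1 hw _).tsum_eq, tsum_mul_left] at h
  have h' := tendsto_nhds_unique h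
    ((tendsto_qPoch (-(w * Q)) hp).mul (tendsto_qPoch (-(w⁻¹ * Q)) hp))
  rw [mul_assoc P, ← h']
  field_simp

lemma qPoch_one_left (r : ℝ) : qPoch 1 r = 0 :=
  tprod_of_exists_eq_zero ⟨0, by simp⟩

/-- The general term of the theta series `∑ k, Q ^ (k ^ 2) * w ^ k`. -/
noncomputable def thetaTerm (Q w : ℝ) (k : ℤ) : ℝ := Q ^ (k ^ 2) * w ^ k

lemma thetaTerm_pow {x : ℝ} (hx : 0 < x) (a : ℕ) (b k : ℤ) :
    thetaTerm (x ^ a) (x ^ b) k = x ^ (a * k ^ 2 + b * k) := by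
  rw [thetaTerm, ← zpow_natCast, ← zpow_mul, ← zpow_mul, ← zpow_add₀ hx.ne']

lemma thetaTerm_neg_pow {x : ℝ} (hx : 0 < x) (a : ℕ) (b k : ℤ) :
    thetaTerm (x ^ a) (-x ^ b) k = (-1) ^ k * x ^ (a * k ^ 2 + b * k) := by
  rw [← thetaTerm_pow hx, thetaTerm, thetaTerm, neg_eq_neg_one_mul, mul_zpow]
  ring

/-- The change of variables `(n, m) = (j - 2 k - s, j + k)`, where `s` is the residue of `m - n`
modulo `3`. -/
def quintupleEquiv : Fin 3 × (ℤ × ℤ) ≃ ℤ × ℤ where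
  toFun p := (p.2.1 - 2 * p.2.2 - (p.1 : ℕ), p.2.1 + p.2.2)
  invFun p := (⟨((p.2 - p.1) % 3).toNat, by omega⟩, (p.2 - (p.2 - p.1) / 3, (p.2 - p.1) / 3))
  left_inv := by
    rintro ⟨s, j, k⟩
    have hs := s.isLt
    simp only [Prod.mk.injEq, Fin.ext_iff]
    omega
  right_inv := by
    rintro ⟨n, m⟩
    simp only [Prod.mk.injEq]
    omega

lemma tsum_int_even_add_odd {f : ℤ → ℝ} (hf : Summable f) :
    ∑' m : ℤ, (f (2 * m) + f (2 * m + 1)) = ∑' j, f j := by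
  have h := ((Int.divModEquiv 2).symm.summable_iff.mpr hf).tsum_prod
  simp only [Function.comp_apply] at h
  rw [← (Int.divModEquiv 2).symm.tsum_eq f, h]
  refine tsum_congr fun m ↦ ?_
  rw [tsum_fintype, Fin.sum_univ_two]
  simp only [Int.divModEquiv_symm_apply]
  congr 2 <;> simp <;> ring

section

variable {x : ℝ}

lemma summable_norm_thetaTerm_neg_pow (hx0 : 0 < x) (hx1 : x < 1) {a : ℕ} (ha : a ≠ 0) (b : ℤ) :
    Summable fun k ↦ ‖thetaTerm (x ^ a) (-x ^ b) k‖ :=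
  summable_zpow_sq_mul_zpow_s9 (by positivity) (pow_lt_one₀ hx0.le hx1 ha)
    (neg_ne_zero.mpr (zpow_ne_zero b hx0.ne'))

lemma tsum_thetaTerm_neg_pow (hx0 : 0 < x) (hx1 : x < 1) {a : ℕ} (ha : a ≠ 0) (b : ℤ) :
    ∑' k, thetaTerm (x ^ a) (-x ^ b) k = qPoch (x ^ (2 * a)) (x ^ (2 * a)) *
      qPoch (x ^ (a + b)) (x ^ (2 * a)) * qPoch (x ^ (a - b)) (x ^ (2 * a)) := by
  have h := jacobi_triple_product_s9 (Q := x ^ a) (w := -x ^ b) (by positivity)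
    (pow_lt_one₀ hx0.le hx1 ha) (neg_ne_zero.mpr (zpow_ne_zero b hx0.ne'))
  have e1 : (x ^ a) ^ 2 = x ^ (2 * a) := by ring
  have e2 : -(-x ^ b * x ^ a) = x ^ (a + b) := by
    rw [zpow_add₀ hx0.ne', zpow_natCast]
    ring
  have e3 : -((-x ^ b)⁻¹ * x ^ a) = x ^ (a - b) := by
    rw [zpow_sub₀ hx0.ne', zpow_natCast, inv_neg]
    ring
  rwa [e1, e2, e3] at h

/-- The product of two theta series, regrouped modulo `3`. -/
lemma tsum_mul_tsum_thetaTerm (hx0 : 0 < x) (hx1 : x < 1) :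
    (∑' k, thetaTerm (x ^ 5) (x ^ (2 : ℤ)) k) * ∑' k, thetaTerm (x ^ 10) (-x ^ (-6 : ℤ)) k =
      (∑' k, thetaTerm (x ^ 30) (-x ^ (10 : ℤ)) k) *
        ∑' j, (thetaTerm (x ^ 15) (-x ^ (-4 : ℤ)) j +
          x ^ 3 * thetaTerm (x ^ 15) (-x ^ (-14 : ℤ)) j) := by
  have hx := hx0.ne'
  have sA : Summable fun k ↦ ‖thetaTerm (x ^ 5) (x ^ (2 : ℤ)) k‖ :=
    summable_zpow_sq_mul_zpow_s9 (by positivity) (pow_lt_one₀ hx0.le hx1 (by norm_num))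
      (zpow_ne_zero 2 hx)
  have sN {a : ℕ} (ha : a ≠ 0) (b : ℤ) := summable_norm_thetaTerm_neg_pow hx0 hx1 ha b
  have sB := sN (a := 10) (by norm_num) (-6)
  have s15 := sN (a := 15) (by norm_num)
  have s30 := sN (a := 30) (by norm_num)
  have key (b₀ b₁ c : ℤ) (s : Fin 3) (h₀ : b₀ = -4 - 10 * (s : ℕ)) (h₁ : b₁ = 20 * (s : ℕ) - 10)
      (hc : c = 5 * (s : ℕ) ^ 2 - 2 * (s : ℕ)) :
      ∑' p : ℤ × ℤ, thetaTerm (x ^ 5) (x ^ (2 : ℤ)) (quintupleEquiv (s, p)).1 *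
        thetaTerm (x ^ 10) (-x ^ (-6 : ℤ)) (quintupleEquiv (s, p)).2 =
      x ^ c * (∑' j, thetaTerm (x ^ 15) (-x ^ b₀) j) * ∑' k, thetaTerm (x ^ 30) (-x ^ b₁) k := by
    rw [mul_assoc, tsum_mul_tsum_of_summable_norm (s15 b₀) (s30 b₁), ← tsum_mul_left]
    refine tsum_congr fun ⟨j, k⟩ ↦ ?_
    simp only [quintupleEquiv, Equiv.coe_fn_mk]
    simp only [thetaTerm_pow hx0, thetaTerm_neg_pow hx0]
    rw [zpow_add₀ (show (-1 : ℝ) ≠ 0 by norm_num)]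
    have hexp : x ^ (((5 : ℕ) : ℤ) * (j - 2 * k - (s : ℕ)) ^ 2 + 2 * (j - 2 * k - (s : ℕ))) *
        x ^ (((10 : ℕ) : ℤ) * (j + k) ^ 2 + -6 * (j + k)) =
        x ^ c * (x ^ (((15 : ℕ) : ℤ) * j ^ 2 + b₀ * j) *
          x ^ (((30 : ℕ) : ℤ) * k ^ 2 + b₁ * k)) := by
      rw [← zpow_add₀ hx, ← zpow_add₀ hx, ← zpow_add₀ hx]
      congr 1
      subst h₀ h₁ hc
      push_cast
      ring
    linear_combination ((-1) ^ j * (-1) ^ k) * hexp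
  have hsum := quintupleEquiv.summable_iff.mpr (summable_mul_of_summable_norm sA sB)
  rw [tsum_mul_tsum_of_summable_norm sA sB, ← quintupleEquiv.tsum_eq]
  have hprod := hsum.tsum_prod
  simp only [Function.comp_apply] at hprod
  rw [hprod, tsum_fintype, Fin.sum_univ_three, key (-4) (-10) 0 0 (by simp) (by simp) (by simp),
    key (-14) 10 3 1 (by simp) (by simp) (by simp), key (-24) 30 16 2 (by simp) (by simp) (by simp),
    (s15 (-4)).of_norm.tsum_add ((s15 (-14)).of_norm.mul_left _), tsum_mul_left]
  have t := fun b ↦ tsum_thetaTerm_neg_pow hx0 hx1 (a := 30) (by norm_num) b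
  have t2 : ∑' k, thetaTerm (x ^ 30) (-x ^ (30 : ℤ)) k = 0 := by
    rw [t]
    simp [qPoch_one_left]
  have t0 : ∑' k, thetaTerm (x ^ 30) (-x ^ (-10 : ℤ)) k =
      ∑' k, thetaTerm (x ^ 30) (-x ^ (10 : ℤ)) k := by
    rw [t, t]
    norm_num
    ring
  rw [t2, t0]
  norm_cast
  ring

lemma abs_pow_lt_one (hx0 : 0 < x) (hx1 : x < 1) {a : ℕ} (ha : a ≠ 0) : |x ^ a| < 1 :=
  abs_lt_one_of_pos (by positivity) (pow_lt_one₀ hx0.le hx1 ha)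

/-- The product side of the quintuple product identity used below, reduced to an Euler product. -/
lemma qPoch_quintuple (hx0 : 0 < x) (hx1 : x < 1) :
    (qPoch (x ^ 10) (x ^ 10) * qPoch (-x ^ 7) (x ^ 10) * qPoch (-x ^ 3) (x ^ 10)) *
        (qPoch (x ^ 20) (x ^ 20) * qPoch (x ^ 4) (x ^ 20) * qPoch (x ^ 16) (x ^ 20)) *
        (qPoch (x ^ 2) (x ^ 5) * qPoch (x ^ 3) (x ^ 5)) =
      (qPoch (x ^ 60) (x ^ 60) * qPoch (x ^ 40) (x ^ 60) * qPoch (x ^ 20) (x ^ 60)) *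
        qPoch (x ^ 2) (x ^ 2) := by
  have split (b a k : ℕ) (ha : a ≠ 0) (hk : k ≠ 0) :
      qPoch (x ^ b) (x ^ a) = ∏ i ∈ range k, qPoch (x ^ (b + a * i)) (x ^ (a * k)) := by
    rw [qPoch_split _ (abs_pow_lt_one hx0 hx1 ha) hk]
    simp only [← pow_mul, ← pow_add]
  have double (b : ℕ) : qPoch (x ^ b) (x ^ 10) * qPoch (-x ^ b) (x ^ 10) =
      qPoch (x ^ (b * 2)) (x ^ 20) := by
    rw [qPoch_mul_qPoch_neg _ (abs_pow_lt_one hx0 hx1 (by norm_num)), ← pow_mul, ← pow_mul]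
  have s20 := split 20 20 3 (by norm_num) (by norm_num)
  have s2 := split 2 2 5 (by norm_num) (by norm_num)
  have s25 := split 2 5 2 (by norm_num) (by norm_num)
  have s35 := split 3 5 2 (by norm_num) (by norm_num)
  have s4 := split 4 10 2 (by norm_num) (by norm_num)
  have s6 := split 6 10 2 (by norm_num) (by norm_num)
  have d7 := double 7
  have d3 := double 3
  norm_num [prod_range_succ] at s20 s2 s25 s35 s4 s6 d7 d3
  rw [s2, s25, s35, s4, s6, ← d7, ← d3, s20]
  ring

end

lemma eulerProd_sq (x : ℝ) : eulerProd (x ^ 2) = qPoch (x ^ 2) (x ^ 2) :=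
  tprod_congr fun n ↦ by rw [pow_succ' (x ^ 2)]

lemma rpow_eq_rpow_half_zpow {q : ℝ} (hq : 0 < q) (r : ℝ) (n : ℤ) (h : (n : ℝ) = 2 * r) :
    q ^ r = (q ^ (1 / 2 : ℝ)) ^ n := by
  rw [← Real.rpow_intCast, ← Real.rpow_mul hq.le, h]
  congr 1
  ring

theorem quintuple_series_identity (q : ℝ) (hq0 : 0 < q) (hq1 : q < 1) :
    (∑' m : ℤ, ((q ^ (30 * (m : ℝ) ^ 2 - 4 * (m : ℝ))
        - q ^ (30 * (m : ℝ) ^ 2 + 16 * (m : ℝ) + 2)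
        + q ^ (30 * (m : ℝ) ^ 2 - 14 * (m : ℝ) + 3 / 2)
        - q ^ (30 * (m : ℝ) ^ 2 + 26 * (m : ℝ) + 11 / 2)))) =
      eulerProd q /
        ∏' n : ℕ, ((1 - q ^ ((5 * (n : ℝ) + 2) / 2)) * (1 - q ^ ((5 * (n : ℝ) + 3) / 2))) := by
  have conv := rpow_eq_rpow_half_zpow hq0
  have hq : q = (q ^ (1 / 2 : ℝ)) ^ 2 := by simpa using conv 1 2 (by norm_num)
  have hx0 : 0 < q ^ (1 / 2 : ℝ) := Real.rpow_pos_of_pos hq0 _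
  have hx1 : q ^ (1 / 2 : ℝ) < 1 := Real.rpow_lt_one hq0.le hq1 (by norm_num)
  generalize q ^ (1 / 2 : ℝ) = x at conv hq hx0 hx1
  have hx := hx0.ne'
  have hden : ∏' n : ℕ, ((1 - q ^ ((5 * (n : ℝ) + 2) / 2)) * (1 - q ^ ((5 * (n : ℝ) + 3) / 2))) =
      qPoch (x ^ 2) (x ^ 5) * qPoch (x ^ 3) (x ^ 5) := by
    have h5 := abs_pow_lt_one hx0 hx1 (a := 5) (by norm_num)
    rw [qPoch, qPoch, ← (multipliable_qPoch _ h5).tprod_mul (multipliable_qPoch _ h5)]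
    refine tprod_congr fun n ↦ ?_
    rw [conv _ (2 + 5 * n : ℕ) (by push_cast; ring), conv _ (3 + 5 * n : ℕ) (by push_cast; ring),
      zpow_natCast, zpow_natCast, pow_add, pow_add, pow_mul]
  have hnum : eulerProd q = qPoch (x ^ 2) (x ^ 2) := by rw [hq, eulerProd_sq]
  have s15 (b : ℤ) := (summable_norm_thetaTerm_neg_pow hx0 hx1 (a := 15) (by norm_num) b).of_norm
  have hseries : (∑' m : ℤ, ((q ^ (30 * (m : ℝ) ^ 2 - 4 * (m : ℝ))
        - q ^ (30 * (m : ℝ) ^ 2 + 16 * (m : ℝ) + 2)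
        + q ^ (30 * (m : ℝ) ^ 2 - 14 * (m : ℝ) + 3 / 2)
        - q ^ (30 * (m : ℝ) ^ 2 + 26 * (m : ℝ) + 11 / 2)))) =
      ∑' j, (thetaTerm (x ^ 15) (-x ^ (-4 : ℤ)) j +
        x ^ 3 * thetaTerm (x ^ 15) (-x ^ (-14 : ℤ)) j) := by
    rw [← tsum_int_even_add_odd ((s15 (-4)).add ((s15 (-14)).mul_left (x ^ 3)))]
    refine tsum_congr fun m ↦ ?_
    have he : (-1 : ℝ) ^ (2 * m) = 1 := (even_two_mul m).neg_one_zpow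
    have ho : (-1 : ℝ) ^ (2 * m + 1) = -1 := Odd.neg_one_zpow ⟨m, rfl⟩
    simp only [thetaTerm_neg_pow hx0, he, ho]
    rw [conv (30 * (m : ℝ) ^ 2 - 4 * (m : ℝ)) (60 * m ^ 2 - 8 * m) (by push_cast; ring),
      conv (30 * (m : ℝ) ^ 2 + 16 * (m : ℝ) + 2) (3 + (60 * m ^ 2 + 32 * m + 1))
        (by push_cast; ring),
      conv (30 * (m : ℝ) ^ 2 - 14 * (m : ℝ) + 3 / 2) (3 + (60 * m ^ 2 - 28 * m))
        (by push_cast; ring),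
      conv (30 * (m : ℝ) ^ 2 + 26 * (m : ℝ) + 11 / 2) (60 * m ^ 2 + 52 * m + 11)
        (by push_cast; ring), zpow_add₀ hx 3, zpow_add₀ hx 3]
    have e₁ : ((15 : ℕ) : ℤ) * (2 * m) ^ 2 + -4 * (2 * m) = 60 * m ^ 2 - 8 * m := by
      push_cast; ring
    have e₂ : ((15 : ℕ) : ℤ) * (2 * m + 1) ^ 2 + -14 * (2 * m + 1) = 60 * m ^ 2 + 32 * m + 1 := by
      push_cast; ring
    have e₃ : ((15 : ℕ) : ℤ) * (2 * m) ^ 2 + -14 * (2 * m) = 60 * m ^ 2 - 28 * m := by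
      push_cast; ring
    have e₄ : ((15 : ℕ) : ℤ) * (2 * m + 1) ^ 2 + -4 * (2 * m + 1) = 60 * m ^ 2 + 52 * m + 11 := by
      push_cast; ring
    rw [e₁, e₂, e₃, e₄, zpow_ofNat]
    ring
  have hmul := tsum_mul_tsum_thetaTerm hx0 hx1
  have hA : ∑' k, thetaTerm (x ^ 5) (x ^ (2 : ℤ)) k =
      qPoch (x ^ 10) (x ^ 10) * qPoch (-x ^ 7) (x ^ 10) * qPoch (-x ^ 3) (x ^ 10) := by
    have h := jacobi_triple_product_s9 (Q := x ^ 5) (w := x ^ (2 : ℤ)) (by positivity)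
      (pow_lt_one₀ hx0.le hx1 (by norm_num)) (zpow_ne_zero 2 hx)
    have e1 : (x ^ 5) ^ 2 = x ^ 10 := by ring
    have e2 : x ^ (2 : ℤ) * x ^ 5 = x ^ 7 := by norm_cast; ring
    have e3 : (x ^ (2 : ℤ))⁻¹ * x ^ 5 = x ^ 3 := by norm_cast; field_simp
    rwa [e1, e2, e3] at h
  have hB : ∑' k, thetaTerm (x ^ 10) (-x ^ (-6 : ℤ)) k =
      qPoch (x ^ 20) (x ^ 20) * qPoch (x ^ 4) (x ^ 20) * qPoch (x ^ 16) (x ^ 20) := by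
    rw [tsum_thetaTerm_neg_pow hx0 hx1 (by norm_num)]
    norm_num
  have hE : ∑' k, thetaTerm (x ^ 30) (-x ^ (10 : ℤ)) k =
      qPoch (x ^ 60) (x ^ 60) * qPoch (x ^ 40) (x ^ 60) * qPoch (x ^ 20) (x ^ 60) := by
    rw [tsum_thetaTerm_neg_pow hx0 hx1 (by norm_num)]
    norm_num
  have hne {b a : ℕ} (hb : b ≠ 0) (ha : a ≠ 0) : qPoch (x ^ b) (x ^ a) ≠ 0 :=
    qPoch_ne_zero (abs_pow_lt_one hx0 hx1 hb) (abs_pow_lt_one hx0 hx1 ha)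
  have hEne : qPoch (x ^ 60) (x ^ 60) * qPoch (x ^ 40) (x ^ 60) * qPoch (x ^ 20) (x ^ 60) ≠ 0 := by
    refine mul_ne_zero (mul_ne_zero ?_ ?_) ?_ <;> exact hne (by norm_num) (by norm_num)
  rw [hseries, hnum, hden, eq_div_iff (mul_ne_zero (hne (by norm_num) (by norm_num))
    (hne (by norm_num) (by norm_num)))]
  refine mul_left_cancel₀ hEne ?_
  rw [← qPoch_quintuple hx0 hx1, ← hA, ← hB, hmul, hE]
  ring
end
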